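/- arXiv:2310.15207 — 2 statements merged into one kernel-verified Lean document; each statement's English description precedes it below -/
import Mathlib

section
/- Let n > 1 be an odd integer and r ≥ 1. Then, modulo Φ_{n^r}(q) · ∏_{j=1}^r Φ_{n^j}(q), one has ∑_{k=0}^{n^r-1} (q;q^2)_k^2 / (q^2;q^2)_k^2 ≡ (-1)^{(n-1)/2} q^{(1-n)(1+n^{2r-1})/4} · ∑_{k=0}^{n^{r-1}-1} (q^n;q^{2n})_k^2 / (q^{2n};q^{2n})_k^2. -/
open Finset Polynomial

/-- The q-shifted factorial `(a;Q)_k` in `ℚ(q)`. -/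
noncomputable def poch (a Q : RatFunc ℚ) (k : ℕ) : RatFunc ℚ :=
  ∏ i ∈ Finset.range k, (1 - a * Q ^ i)

/-- `f` has `p`-adic order at least `e`. -/
def POrd (p : ℚ[X]) (e : ℕ) (f : RatFunc ℚ) : Prop :=
  ∃ a b : ℚ[X], ¬ p ∣ b ∧ f * algebraMap ℚ[X] (RatFunc ℚ) b
    = algebraMap ℚ[X] (RatFunc ℚ) (p ^ e * a)

section Ordlemmas
variable {p : ℚ[X]}


lemma POrd.poly (hp : Prime p) {e : ℕ} {a : ℚ[X]} (h : p ^ e ∣ a) : POrd p e (algebraMap ℚ[X] (RatFunc ℚ) a) := by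
  obtain ⟨c, rfl⟩ := h
  exact ⟨c, 1, fun h => hp.not_isUnit (isUnit_of_dvd_one h), by simp⟩

lemma POrd.zero (hp : Prime p) (e : ℕ) : POrd p e 0 := by
  simpa using POrd.poly hp (dvd_zero (p ^ e))

lemma POrd.one (hp : Prime p) : POrd p 0 1 := by
  simpa using POrd.poly hp (e := 0) (a := 1) (by simp)

lemma POrd.add (hp : Prime p) {e : ℕ} {f g : RatFunc ℚ} (hf : POrd p e f) (hg : POrd p e g) : POrd p e (f + g) := by
  obtain ⟨a, b, hb, h1⟩ := hf
  obtain ⟨c, d, hd, h2⟩ := hg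
  refine ⟨a * d + c * b, b * d, fun h => (hp.dvd_or_dvd h).elim hb hd, ?_⟩
  simp only [map_mul, map_add] at *
  linear_combination algebraMap ℚ[X] (RatFunc ℚ) d * h1 + algebraMap ℚ[X] (RatFunc ℚ) b * h2

lemma POrd.mul (hp : Prime p) {e e' : ℕ} {f g : RatFunc ℚ} (hf : POrd p e f) (hg : POrd p e' g) :
    POrd p (e + e') (f * g) := by
  obtain ⟨a, b, hb, h1⟩ := hf
  obtain ⟨c, d, hd, h2⟩ := hg
  refine ⟨a * c, b * d, fun h => (hp.dvd_or_dvd h).elim hb hd, ?_⟩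
  have : f * g * algebraMap ℚ[X] (RatFunc ℚ) (b * d) = (f * algebraMap ℚ[X] (RatFunc ℚ) b) *
    (g * algebraMap ℚ[X] (RatFunc ℚ) d) := by rw [map_mul]; ring
  rw [this, h1, h2, ← map_mul]; congr 1; ring

lemma POrd.mulr (hp : Prime p) {e : ℕ} {f g : RatFunc ℚ} (hf : POrd p e f) (hg : POrd p 0 g) :
    POrd p e (f * g) := by
  have h := POrd.mul hp hf hg
  rwa [add_zero] at h

lemma POrd.mull (hp : Prime p) {e : ℕ} {f g : RatFunc ℚ} (hf : POrd p 0 f) (hg : POrd p e g) :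
    POrd p e (f * g) := by simpa using POrd.mul hp hf hg

lemma POrd.neg (hp : Prime p) {e : ℕ} {f : RatFunc ℚ} (hf : POrd p e f) : POrd p e (-f) := by
  have h1 : POrd p 0 (-1) := by simpa using POrd.poly hp (e := 0) (a := -1) (by simp)
  simpa using POrd.mull hp h1 hf

lemma POrd.sub (hp : Prime p) {e : ℕ} {f g : RatFunc ℚ} (hf : POrd p e f) (hg : POrd p e g) : POrd p e (f - g) := by
  rw [sub_eq_add_neg]; exact POrd.add hp hf (POrd.neg hp hg)

lemma POrd.mono (hp : Prime p) {e : ℕ} {f : RatFunc ℚ} (hf : POrd p e f) : POrd p 0 f := by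
  obtain ⟨a, b, hb, h1⟩ := hf
  exact ⟨p ^ e * a, b, hb, by simpa using h1⟩

lemma POrd.pow (hp : Prime p) {f : RatFunc ℚ} (hf : POrd p 0 f) (k : ℕ) : POrd p 0 (f ^ k) := by
  induction k with
  | zero => simpa using POrd.one hp
  | succ k ih => rw [pow_succ]; exact POrd.mulr hp ih hf

lemma POrd.sum (hp : Prime p) {e : ℕ} {ι : Type} (s : Finset ι) (f : ι → RatFunc ℚ)
    (hf : ∀ i ∈ s, POrd p e (f i)) : POrd p e (∑ i ∈ s, f i) :=
  Finset.sum_induction f (POrd p e) (fun _ _ => POrd.add hp) (POrd.zero hp e) hf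

lemma POrd.prod (hp : Prime p) {ι : Type} (s : Finset ι) (f : ι → RatFunc ℚ)
    (hf : ∀ i ∈ s, POrd p 0 (f i)) : POrd p 0 (∏ i ∈ s, f i) :=
  Finset.prod_induction f (POrd p 0) (fun _ _ => POrd.mulr hp) (POrd.one hp) hf

lemma POrd.inv (hp : Prime p) {b : ℚ[X]} (hb : ¬ p ∣ b) : POrd p 0 (algebraMap ℚ[X] (RatFunc ℚ) b)⁻¹ := by
  refine ⟨1, b, hb, ?_⟩
  have : algebraMap ℚ[X] (RatFunc ℚ) b ≠ 0 := by
    intro h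
    apply hb
    rw [(map_eq_zero_iff _ (IsFractionRing.injective ℚ[X] (RatFunc ℚ))).1 h]
    exact dvd_zero p
  simp [inv_mul_cancel₀ this]

lemma POrd.num (hp : Prime p) {e : ℕ} {f : RatFunc ℚ} (hf : POrd p e f) : p ^ e ∣ f.num := by
  obtain ⟨a, b, hb, h1⟩ := hf
  have h2 : f.num * b = p ^ e * a * f.denom := by
    apply IsFractionRing.injective ℚ[X] (RatFunc ℚ)
    have hd : algebraMap ℚ[X] (RatFunc ℚ) f.denom ≠ 0 := by
      intro h
      exact f.denom_ne_zero ((map_eq_zero_iff _ (IsFractionRing.injective ℚ[X] (RatFunc ℚ))).1 h)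
    have h3 := RatFunc.num_div_denom f
    rw [div_eq_iff hd] at h3
    rw [map_mul, map_mul, h3, ← h1]; ring
  exact (hp.pow_dvd_of_dvd_mul_right e hb (by rw [h2, mul_assoc]; exact dvd_mul_right _ _))

lemma POrd.mulcongr (hp : Prime p) {e : ℕ} {f f' g g' : RatFunc ℚ} (h : POrd p e (f - f')) (h' : POrd p e (g - g'))
    (hf : POrd p 0 f') (hg : POrd p 0 g) : POrd p e (f * g - f' * g') := by
  have : f * g - f' * g' = (f - f') * g + f' * (g - g') := by ring
  rw [this]
  exact POrd.add hp (POrd.mulr hp h hg) (POrd.mull hp hf h')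

lemma POrd.prodcongr (hp : Prime p) {e : ℕ} (k : ℕ) (f g : ℕ → RatFunc ℚ)
    (hf : ∀ i < k, POrd p 0 (f i)) (hg : ∀ i < k, POrd p 0 (g i))
    (h : ∀ i < k, POrd p e (f i - g i)) :
    POrd p e (∏ i ∈ range k, f i - ∏ i ∈ range k, g i) := by
  induction k with
  | zero => simpa using POrd.zero hp e
  | succ k ih =>
    rw [prod_range_succ, prod_range_succ]
    refine POrd.mulcongr hp (ih (fun i hi => hf i (by omega)) (fun i hi => hg i (by omega))
      (fun i hi => h i (by omega))) (h k (by omega)) ?_ (hf k (by omega))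
    exact POrd.prod hp _ _ (fun i hi => hg i (by have := mem_range.1 hi; omega))

lemma POrd.divcongr (hp : Prime p) {e : ℕ} {f f' g g' : RatFunc ℚ} (h : POrd p e (f - f')) (h' : POrd p e (g - g'))
    (hf : POrd p 0 f') (hg : POrd p 0 g⁻¹) (hg' : POrd p 0 g'⁻¹) (h0 : g ≠ 0) (h0' : g' ≠ 0) :
    POrd p e (f / g - f' / g') := by
  rw [div_eq_mul_inv, div_eq_mul_inv]
  refine POrd.mulcongr hp h ?_ hf hg
  have : g⁻¹ - g'⁻¹ = -(g - g') * (g⁻¹ * g'⁻¹) := by field_simp; ring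
  rw [this]
  exact POrd.mulr hp (POrd.neg hp h') (POrd.mulr hp hg hg')
end Ordlemmas

/-! ### q-Chu–Vandermonde -/

section CV
variable {F : Type} [Field F]

/-- q-shifted factorial over a field -/
def P (a Q : F) (k : ℕ) : F := ∏ i ∈ range k, (1 - a * Q ^ i)

lemma P_succ (a Q : F) (k : ℕ) : P a Q (k+1) = P a Q k * (1 - a * Q ^ k) := prod_range_succ _ _

lemma P_succ' (a Q : F) (k : ℕ) : P a Q (k+1) = (1 - a) * P (a * Q) Q k := by
  unfold P; rw [prod_range_succ', mul_comm]; congr 1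
  · simp
  · apply prod_congr rfl; intros; ring

lemma P_zero_of (a Q : F) (k j : ℕ) (hj : j < k) (h : a * Q ^ j = 1) : P a Q k = 0 :=
  prod_eq_zero (mem_range.2 hj) (by rw [h, sub_self])

lemma tele (Q x : F) (K : ℕ) (hx : x ≠ 0) (hQ : ∀ i, 0 < i → i ≤ K → 1 - Q ^ i ≠ 0) :
    (∑ k ∈ range (K+1), Q ^ k * (P x Q k * P x⁻¹ Q k / (P Q Q k)^2)) * (2 - x - x⁻¹)
      = P x Q (K+1) * P x⁻¹ Q (K+1) / (P Q Q K) ^ 2 := by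
  induction K with
  | zero => simp [P]; field_simp; ring
  | succ K ih =>
    have hK : P Q Q K ≠ 0 := by
      apply prod_ne_zero_iff.2
      intro i hi
      have := mem_range.1 hi
      rw [← pow_succ']; exact hQ _ (by omega) (by omega)
    have h1 : 1 - Q * Q ^ K ≠ 0 := by rw [← pow_succ']; exact hQ _ (by omega) (by omega)
    rw [sum_range_succ, add_mul, ih (fun i h h' => hQ i h (by omega)), P_succ x Q (K+1),
      P_succ x⁻¹ Q (K+1), P_succ Q Q K]
    generalize P x Q (K+1) = A
    generalize P x⁻¹ Q (K+1) = B
    rw [pow_succ' Q K]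
    field_simp
    ring

lemma chu (y : F) (K : ℕ) (hy : y ≠ 0) (hQ : ∀ i, 0 < i → i ≤ K → 1 - (y^2) ^ i ≠ 0) (h : ℕ)
    (hh : h ≤ K) :
    ∑ k ∈ range (K+1), P ((y^2)^h)⁻¹ (y^2) k * P ((y^2)^(h+1)) (y^2) k / (P (y^2) (y^2) k)^2
      = (-1)^h * (y^(h*(h+1)))⁻¹ := by
  induction h with
  | zero =>
    rw [sum_range_succ']
    simp only [pow_zero, inv_one, mul_one, zero_add, pow_one]
    rw [sum_eq_zero, zero_add]
    · simp [P]
    · intro k _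
      rw [P_zero_of 1 (y^2) (k+1) 0 (by omega) (by simp)]; simp
  | succ h ih =>
    have ih := ih (by omega)
    set Q := y^2 with hQdef
    have hQ0 : Q ≠ 0 := pow_ne_zero _ hy
    have hx1 := hQ (h+1) (by omega) hh
    set x := Q^(h+1) with hx
    have hx0 : x ≠ 0 := pow_ne_zero _ hQ0
    have hxi : 1 - x⁻¹ ≠ 0 := by
      intro h; apply hx1; field_simp at h; linear_combination -h
    have ht := tele Q x K hx0 hQ
    rw [P_zero_of x⁻¹ Q (K+1) (h+1) (by omega) (inv_mul_cancel₀ hx0)] at ht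
    have h2 : (2 - x - x⁻¹) = (1 - x) * (1 - x⁻¹) := by field_simp; ring
    rw [h2, mul_zero, zero_div] at ht
    have ht0 := (mul_eq_zero.1 ht).resolve_right (mul_ne_zero hx1 hxi)
    have key : ∀ k, x * (P x⁻¹ Q k * P (Q^(h+1+1)) Q k / (P Q Q k)^2)
        + P (Q^h)⁻¹ Q k * P x Q k / (P Q Q k)^2
        = (x - x⁻¹) / (1 - x⁻¹) * (Q ^ k * (P x Q k * P x⁻¹ Q k / (P Q Q k)^2)) := by
      intro k
      have e1 : (1 - x⁻¹) * P (Q^h)⁻¹ Q k = P x⁻¹ Q k * (1 - x⁻¹ * Q^k) := by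
        rw [← P_succ, P_succ']; congr 2; rw [hx, pow_succ]; field_simp
      have e2 : (1 - x) * P (Q^(h+1+1)) Q k = P x Q k * (1 - x * Q^k) := by
        rw [← P_succ, P_succ', pow_succ]
      have e1' : P (Q^h)⁻¹ Q k = P x⁻¹ Q k * (1 - x⁻¹ * Q^k) / (1 - x⁻¹) := by
        rw [eq_div_iff hxi, ← e1]; ring
      have e2' : P (Q^(h+1+1)) Q k = P x Q k * (1 - x * Q^k) / (1 - x) := by
        rw [eq_div_iff hx1, ← e2]; ring
      rw [e1', e2']
      generalize P x Q k = A
      generalize P x⁻¹ Q k = B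
      have : 1 - x⁻¹ = - (1 - x) / x := by field_simp; ring
      rw [this]
      generalize P Q Q k = D
      rw [div_eq_mul_inv, div_eq_mul_inv _ (D^2), div_eq_mul_inv _ (D^2)]
      generalize (D^2)⁻¹ = D'
      field_simp
      ring
    have hs := sum_congr (rfl : range (K+1) = range (K+1)) (fun k _ => key k)
    rw [← mul_sum, ht0, mul_zero, sum_add_distrib, ← mul_sum, ih] at hs
    have hxy : x = y^(2*(h+1)) := by rw [hx, hQdef, ← pow_mul]
    have h3 : y^((h+1)*(h+1+1)) = y^(h*(h+1)) * x := by rw [hxy, ← pow_add]; congr 1; ring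
    rw [h3]
    have hyy : y^(h*(h+1)) ≠ 0 := pow_ne_zero _ hy
    rw [pow_succ (-1 : F)]
    have := mul_left_cancel₀ hx0 (show x * _ = x * ((-1)^h * (-1) * (y^(h*(h+1)) * x)⁻¹) from by
      rw [eq_neg_of_add_eq_zero_left hs]; field_simp)
    exact this
end CV

/-! ### congruences -/

/-- `y` behaves as a primitive `M`-th root of unity modulo `p`. -/
structure Good (p : ℚ[X]) (y : RatFunc ℚ) (M : ℕ) : Prop where
  hp : Prime p
  h0 : POrd p 0 y
  hi : POrd p 0 y⁻¹
  y0 : y ≠ 0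
  hM : POrd p 1 (1 - y ^ M)
  hU : ∀ i, ¬ M ∣ i → POrd p 0 (1 - y ^ i)⁻¹
  hn : ∀ i, 0 < i → 1 - y ^ i ≠ 0
  hz : ∀ k, 0 < k → POrd p 0 ((1 - y ^ M) / (1 - (y ^ M) ^ k))
  hz' : ∀ k, 0 < k → POrd p 0 ((1 - (y ^ M) ^ k) / (1 - y ^ M))

/-- square root of the summand -/
noncomputable def T (y : RatFunc ℚ) (k : ℕ) : RatFunc ℚ :=
  ∏ i ∈ range k, ((1 - y ^ (2 * i + 1)) / (1 - y ^ (2 * i + 2)))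

lemma T_eq (y : RatFunc ℚ) (k : ℕ) : T y k = P y (y^2) k / P (y^2) (y^2) k := by
  unfold T P
  rw [← prod_div_distrib]
  apply prod_congr rfl
  intro i _
  congr 2 <;> ring

namespace Good
variable {p : ℚ[X]} {y : RatFunc ℚ} {M : ℕ}

lemma hsub (G : Good p y M) (i : ℕ) : POrd p 0 (1 - y ^ i) :=
  POrd.sub G.hp (POrd.one G.hp) (POrd.pow G.hp G.h0 i)

lemma shift (G : Good p y M) (i a : ℕ) : POrd p 1 (y ^ (a * M + i) - y ^ i) := by
  induction a with
  | zero => simpa using POrd.zero G.hp 1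
  | succ a ih =>
    have : y ^ ((a+1) * M + i) - y ^ i = (y ^ (a * M + i) - y ^ i) - (1 - y ^ M) * y ^ (a * M + i) := by
      ring
    rw [this]
    exact POrd.sub G.hp ih (POrd.mulr G.hp G.hM (POrd.pow G.hp G.h0 _))

lemma shift' (G : Good p y M) (i a : ℕ) : POrd p 1 ((1 - y ^ (a * M + i)) - (1 - y ^ i)) := by
  have := POrd.neg G.hp (G.shift i a)
  convert this using 1; ring

lemma ndvd (hM : Odd M) {i : ℕ} (hi : 0 < i) (hiM : i < M) : ¬ M ∣ 2 * i := by
  intro h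
  have h2 := (Nat.Coprime.dvd_of_dvd_mul_left (Nat.coprime_two_right.2 hM) h)
  exact absurd (Nat.le_of_dvd hi h2) (by omega)

/-- the q-supercongruence modulo `p ^ 2` -/
lemma key {h : ℕ} (G : Good p y (2 * h + 1)) :
    POrd p 2 (∑ k ∈ range (2 * h + 1), (T y k) ^ 2 - (-1) ^ h * (y ^ (h * (h + 1)))⁻¹) := by
  have hodd : Odd (2 * h + 1) := ⟨h, rfl⟩
  have hc := chu y (2 * h) G.y0 (fun i hi _ => by rw [← pow_mul]; exact G.hn _ (by omega)) h (by omega)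
  rw [← hc, ← sum_sub_distrib]
  apply POrd.sum G.hp
  intro k hk
  have hk := mem_range.1 hk
  rw [T_eq, div_pow, ← sub_div, div_eq_mul_inv]
  apply POrd.mulr G.hp
  · have e : ∀ i, (1 - ((y^2)^h)⁻¹ * (y^2)^i) * (1 - (y^2)^(h+1) * (y^2)^i) =
        (1 - y * (y^2)^i)^2 - (1 - y^(2*h+1))^2 * (y * (y^2)^i * (y⁻¹)^(2*h+1)) := by
      intro i
      have := G.y0
      rw [← pow_mul, ← pow_mul, ← pow_mul, inv_pow]
      field_simp
      ring
    have hpr : P ((y^2)^h)⁻¹ (y^2) k * P ((y^2)^(h+1)) (y^2) k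
      = ∏ i ∈ range k, ((1 - ((y^2)^h)⁻¹ * (y^2)^i) * (1 - (y^2)^(h+1) * (y^2)^i)) := by
      unfold P; rw [prod_mul_distrib]
    rw [hpr]
    unfold P
    rw [← prod_pow]
    have hy2 : ∀ i, POrd p 0 (y * (y^2)^i) := fun i =>
      POrd.mulr G.hp G.h0 (POrd.pow G.hp (POrd.pow G.hp G.h0 2) i)
    have hyi : ∀ i, POrd p 0 (y * (y^2)^i * (y⁻¹)^(2*h+1)) := fun i =>
      POrd.mulr G.hp (hy2 i) (POrd.pow G.hp G.hi _)
    have hsq : POrd p 2 ((1 - y^(2*h+1))^2) := by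
      have hmm := POrd.mul G.hp G.hM G.hM
      rwa [← sq, one_add_one_eq_two] at hmm
    have ha : ∀ i, POrd p 0 ((1 - y * (y^2)^i)^2) := fun i =>
      POrd.pow G.hp (POrd.sub G.hp (POrd.one G.hp) (hy2 i)) 2
    refine POrd.prodcongr G.hp k (fun i => (1 - y * (y^2)^i)^2)
      (fun i => (1 - ((y^2)^h)⁻¹ * (y^2)^i) * (1 - (y^2)^(h+1) * (y^2)^i)) (fun i _ => ha i) ?_ ?_
    · intro i _
      simp only [e]
      exact POrd.sub G.hp (ha i) (POrd.mono G.hp (POrd.mulr G.hp hsq (hyi i)))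
    · intro i _
      simp only [e, sub_sub_cancel]
      exact POrd.mulr G.hp hsq (hyi i)
  · rw [← inv_pow]
    apply POrd.pow G.hp
    unfold P
    rw [← prod_inv_distrib]
    apply POrd.prod G.hp
    intro i hi
    have hi := mem_range.1 hi
    have : y^2 * (y^2)^i = y^(2*(i+1)) := by ring
    rw [this]
    exact G.hU _ (ndvd hodd (by omega) (by omega))

lemma Tz_int (G : Good p y M) (a : ℕ) : POrd p 0 (T (y ^ M) a) := by
  apply POrd.prod G.hp
  intro i _
  by_cases hz : 1 - y ^ M = 0
  · have : y ^ M = 1 := by linear_combination -hz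
    rw [this]; simpa using POrd.zero G.hp 0
  have : (1 - (y^M) ^ (2 * i + 1)) / (1 - (y^M) ^ (2 * i + 2)) =
    ((1 - (y^M) ^ (2 * i + 1)) / (1 - y ^ M)) * ((1 - y ^ M) / (1 - (y^M) ^ (2 * i + 2))) := by
    field_simp
  rw [this]
  exact POrd.mulr G.hp (G.hz' _ (by omega)) (G.hz _ (by omega))

/-- partial block -/
lemma part (G : Good p y M) (hM : Odd M) (a b : ℕ) (hb : b < M) :
    POrd p 0 (T y b) ∧
    ∃ u, POrd p 0 u ∧ T y (a * M + b) = T y (a * M) * u ∧ POrd p 1 (u - T y b) := by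
  have hd : ∀ i < b, ∀ c, POrd p 0 (1 - y ^ (c * M + (2 * i + 2)))⁻¹ := by
    intro i hi c
    apply G.hU
    rw [Nat.dvd_add_right (dvd_mul_left M c)]
    exact ndvd hM (i := i + 1) (by omega) (by omega)
  have h1 : ∀ c, ∀ i < b,
      POrd p 0 ((1 - y ^ (c * M + (2 * i + 1))) / (1 - y ^ (c * M + (2 * i + 2)))) := by
    intro c i hi
    rw [div_eq_mul_inv]
    exact POrd.mulr G.hp (G.hsub _) (hd i hi c)
  have h10 := h1 0
  simp only [zero_mul, zero_add] at h10
  refine ⟨POrd.prod G.hp _ _ (fun i hi => h10 i (mem_range.1 hi)),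
    ∏ i ∈ range b, ((1 - y ^ ((2*a) * M + (2 * i + 1))) / (1 - y ^ ((2*a) * M + (2 * i + 2)))),
    POrd.prod G.hp _ _ (fun i hi => h1 _ i (mem_range.1 hi)), ?_, ?_⟩
  · unfold T
    rw [prod_range_add]
    congr 1
    apply prod_congr rfl
    intro i _
    congr 3 <;> ring
  · apply POrd.prodcongr G.hp _ _ _ (h1 _) h10
    intro i hi
    have hd0 := hd i hi 0
    simp only [zero_mul, zero_add] at hd0
    exact POrd.divcongr G.hp (G.shift' _ _) (G.shift' _ _) (G.hsub _) (hd i hi _) hd0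
      (G.hn _ (by omega)) (G.hn _ (by omega))

/-- full block -/
lemma full {h : ℕ} (G : Good p y (2 * h + 1)) (a : ℕ) :
    ∃ u, POrd p 0 u ∧ POrd p 1 (u - 1) ∧
      T y ((a + 1) * (2 * h + 1)) = T y (a * (2 * h + 1)) *
        ((1 - (y ^ (2 * h + 1)) ^ (2 * a + 1)) / (1 - (y ^ (2 * h + 1)) ^ (2 * a + 2)) * u) := by
  have hodd : Odd (2 * h + 1) := ⟨h, rfl⟩
  set M := 2 * h + 1 with hMd
  set N1 := ∏ i ∈ range h, (1 - y ^ ((2 * a) * M + (2 * i + 1))) with hN1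
  set N2 := ∏ i ∈ range h, (1 - y ^ ((2 * a + 1) * M + (2 * i + 2))) with hN2
  set D1 := ∏ i ∈ range h, (1 - y ^ ((2 * a + 1) * M + (2 * i + 1))) with hD1
  set D2 := ∏ i ∈ range h, (1 - y ^ ((2 * a) * M + (2 * i + 2))) with hD2
  have hnum : ∏ i ∈ range M, (1 - y ^ (2 * (a * M + i) + 1)) =
      N1 * (1 - (y ^ M) ^ (2 * a + 1)) * N2 := by
    have : range M = range (h + 1 + h) := by congr 1; omega
    rw [this, prod_range_add, prod_range_succ]
    congr 1
    · congr 1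
      · apply prod_congr rfl; intro i _; congr 2; ring
      · rw [← pow_mul]; congr 2; rw [hMd]; ring
    · apply prod_congr rfl; intro i _; congr 2; rw [hMd]; ring
  have hden : ∏ i ∈ range M, (1 - y ^ (2 * (a * M + i) + 2)) =
      D2 * D1 * (1 - (y ^ M) ^ (2 * a + 2)) := by
    have : range M = range (h + h + 1) := by congr 1; omega
    rw [this, prod_range_succ, prod_range_add]
    congr 1
    · congr 1
      · apply prod_congr rfl; intro i _; congr 2; ring
      · apply prod_congr rfl; intro i _; congr 2; rw [hMd]; ring
    · rw [← pow_mul]; congr 2; rw [hMd]; ring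
  have hu1 : ∀ i < h, ∀ c, POrd p 0 (1 - y ^ (c * M + (2 * i + 1)))⁻¹ := by
    intro i hi c
    apply G.hU
    rw [Nat.dvd_add_right (dvd_mul_left M c)]
    intro hh
    exact absurd (Nat.le_of_dvd (by omega) hh) (by omega)
  have hu2 : ∀ i < h, ∀ c, POrd p 0 (1 - y ^ (c * M + (2 * i + 2)))⁻¹ := by
    intro i hi c
    apply G.hU
    rw [Nat.dvd_add_right (dvd_mul_left M c)]
    intro hh
    exact absurd (Nat.le_of_dvd (by omega) hh) (by omega)
  have hs : ∀ c d j, POrd p 1 ((1 - y ^ (c * M + j)) - (1 - y ^ (d * M + j))) := by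
    intro c d j
    have := POrd.sub G.hp (G.shift' j c) (G.shift' j d)
    convert this using 1; ring
  have gen : ∀ j : ℕ → ℕ, ∀ c d, (∀ i, 0 < j i) → (∀ i < h, ∀ c, POrd p 0 (1 - y ^ (c * M + j i))⁻¹) →
      POrd p 0 (∏ i ∈ range h, ((1 - y ^ (c * M + j i)) / (1 - y ^ (d * M + j i)))) ∧
      POrd p 1 (∏ i ∈ range h, ((1 - y ^ (c * M + j i)) / (1 - y ^ (d * M + j i))) - 1) := by
    intro j c d hj hu
    have hint : ∀ i < h, POrd p 0 ((1 - y ^ (c * M + j i)) / (1 - y ^ (d * M + j i))) := by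
      intro i hi
      rw [div_eq_mul_inv]
      exact POrd.mulr G.hp (G.hsub _) (hu i hi d)
    refine ⟨POrd.prod G.hp _ _ (fun i hi => hint i (mem_range.1 hi)), ?_⟩
    have := POrd.prodcongr G.hp (e := 1) h _ (fun _ => 1) hint (fun _ _ => POrd.one G.hp) ?_
    · simpa using this
    · intro i hi
      have hne : 1 - y ^ (d * M + j i) ≠ 0 := G.hn _ (by have := hj i; omega)
      have e : (1 - y ^ (c * M + j i)) / (1 - y ^ (d * M + j i)) - 1 =
        ((1 - y ^ (c * M + j i)) - (1 - y ^ (d * M + j i))) * (1 - y ^ (d * M + j i))⁻¹ := by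
        rw [sub_mul, mul_inv_cancel₀ hne, div_eq_mul_inv]
      rw [e]
      exact POrd.mulr G.hp (hs _ _ _) (hu i hi d)
  have g1 := gen (fun i => 2 * i + 1) (2 * a) (2 * a + 1) (fun i => by omega) hu1
  have g2 := gen (fun i => 2 * i + 2) (2 * a + 1) (2 * a) (fun i => by omega) hu2
  rw [prod_div_distrib] at g1 g2
  refine ⟨N1 / D1 * (N2 / D2), POrd.mulr G.hp g1.1 g2.1, ?_, ?_⟩
  · have := POrd.mulcongr G.hp g1.2 g2.2 (POrd.one G.hp) g2.1
    simpa using this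
  · rw [add_mul, one_mul]
    unfold T
    rw [prod_range_add]
    congr 1
    rw [prod_div_distrib, hnum, hden, mul_assoc N1, mul_div_mul_comm, div_eq_mul_inv, div_eq_mul_inv]
    simp only [div_eq_mul_inv, mul_inv]
    ring

lemma T_mul {h : ℕ} (G : Good p y (2 * h + 1)) (a : ℕ) :
    POrd p 0 (T y (a * (2 * h + 1))) ∧
      POrd p 1 (T y (a * (2 * h + 1)) - T (y ^ (2 * h + 1)) a) := by
  induction a with
  | zero => simpa [T] using ⟨POrd.one G.hp, POrd.zero G.hp 1⟩
  | succ a ih =>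
    obtain ⟨u, hu, hu1, e⟩ := G.full a
    have hz := G.Tz_int (a + 1)
    have hz0 := G.Tz_int a
    have e2 : T (y ^ (2 * h + 1)) (a + 1) = T (y ^ (2 * h + 1)) a *
      ((1 - (y ^ (2 * h + 1)) ^ (2 * a + 1)) / (1 - (y ^ (2 * h + 1)) ^ (2 * a + 2))) :=
      prod_range_succ _ _
    have hq : POrd p 0 ((1 - (y ^ (2 * h + 1)) ^ (2 * a + 1)) / (1 - (y ^ (2 * h + 1)) ^ (2 * a + 2))) := by
      have hz : 1 - y ^ (2 * h + 1) ≠ 0 := G.hn _ (by omega)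
      have := POrd.mulr G.hp (G.hz' (2 * a + 1) (by omega)) (G.hz (2 * a + 2) (by omega))
      rwa [div_mul_div_cancel₀ hz] at this
    rw [e, e2]
    have hw : POrd p 0 ((1 - (y ^ (2 * h + 1)) ^ (2 * a + 1)) / (1 - (y ^ (2 * h + 1)) ^ (2 * a + 2)) * u) :=
      POrd.mulr G.hp hq hu
    refine ⟨POrd.mulr G.hp ih.1 hw, POrd.mulcongr G.hp ih.2 ?_ hz0 hw⟩
    have := POrd.mull G.hp hq hu1
    rwa [mul_sub, mul_one] at this

lemma lucas {h : ℕ} (G : Good p y (2 * h + 1)) (a b : ℕ) (hb : b < 2 * h + 1) :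
    POrd p 1 ((T y (b + (2 * h + 1) * a)) ^ 2 - (T (y ^ (2 * h + 1)) a) ^ 2 * (T y b) ^ 2) := by
  obtain ⟨hb0, u, hu, e, hu1⟩ := G.part ⟨h, rfl⟩ a b hb
  rw [show b + (2 * h + 1) * a = a * (2 * h + 1) + b by ring, e]
  obtain ⟨h1, h2⟩ := G.T_mul a
  have hz0 := G.Tz_int a
  have h3 := POrd.mulcongr G.hp h2 hu1 hz0 hu
  rw [← mul_pow, sq, sq]
  exact POrd.mulcongr G.hp h3 h3 (POrd.mulr G.hp hz0 hb0) (POrd.mulr G.hp h1 hu)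

/-- modulo `p`, the long sum factors -/
lemma long {h : ℕ} (G : Good p y (2 * h + 1)) (L : ℕ) :
    POrd p 1 (∑ k ∈ range ((2 * h + 1) * L), (T y k) ^ 2 -
      (∑ a ∈ range L, (T (y ^ (2 * h + 1)) a) ^ 2) * ((-1) ^ h * (y ^ (h * (h + 1)))⁻¹)) := by
  have hA : POrd p 0 (∑ a ∈ range L, (T (y ^ (2 * h + 1)) a) ^ 2) :=
    POrd.sum G.hp _ _ (fun a _ => POrd.pow G.hp (G.Tz_int a) 2)
  have h1 : POrd p 1 (∑ k ∈ range ((2 * h + 1) * L), (T y k) ^ 2 -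
      (∑ a ∈ range L, (T (y ^ (2 * h + 1)) a) ^ 2) * ∑ k ∈ range (2 * h + 1), (T y k) ^ 2) := by
    have : ∑ k ∈ range ((2 * h + 1) * L), (T y k) ^ 2 =
      ∑ a ∈ range L, ∑ b ∈ range (2 * h + 1), (T y (b + (2 * h + 1) * a)) ^ 2 := by
      clear hA
      induction L with
      | zero => simp
      | succ L ih =>
        rw [sum_range_succ, ← ih, Nat.mul_succ, sum_range_add]
        congr 1
        apply sum_congr rfl; intro b _; rw [add_comm]
    rw [this, sum_mul_sum, ← sum_sub_distrib]
    apply POrd.sum G.hp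
    intro a _
    rw [← sum_sub_distrib]
    apply POrd.sum G.hp
    intro b hb
    exact G.lucas a b (mem_range.1 hb)
  have h2 : POrd p 1 (∑ k ∈ range (2 * h + 1), (T y k) ^ 2 - (-1) ^ h * (y ^ (h * (h + 1)))⁻¹) := by
    obtain ⟨a, b, hb, e⟩ := G.key
    exact ⟨p * a, b, hb, by rw [e]; congr 1; ring⟩
  have := POrd.add G.hp h1 (POrd.mull G.hp hA h2)
  convert this using 1; ring
end Good

/-! ### cyclotomic polynomials -/

lemma cyc_dvd_iff {m : ℕ} (hm : 0 < m) (i : ℕ) :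
    cyclotomic m ℚ ∣ 1 - X ^ i ↔ m ∣ i := by
  constructor
  · rintro ⟨c, hc⟩
    have hζ := Complex.isPrimitiveRoot_exp m hm.ne'
    set ζ := Complex.exp (2 * Real.pi * Complex.I / m) with hζd
    have hr : aeval ζ (cyclotomic m ℚ) = 0 := by
      have : NeZero (m : ℂ) := ⟨by exact_mod_cast hm.ne'⟩
      have := (isRoot_cyclotomic_iff (n := m) (R := ℂ)).2 hζ
      rw [← map_cyclotomic m (algebraMap ℚ ℂ), IsRoot.def, eval_map_algebraMap] at this
      exact this
    have h2 := congrArg (aeval ζ) hc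
    rw [map_mul, hr, zero_mul] at h2
    simp only [map_sub, map_one, map_pow, aeval_X] at h2
    exact (hζ.pow_eq_one_iff_dvd i).1 (by linear_combination -h2)
  · rintro ⟨k, rfl⟩
    have h1 : cyclotomic m ℚ ∣ X ^ m - 1 := cyclotomic.dvd_X_pow_sub_one m ℚ
    have h2 : (X ^ m - 1 : ℚ[X]) ∣ (X ^ m) ^ k - 1 ^ k := sub_dvd_pow_sub_pow _ _ k
    rw [one_pow, ← pow_mul] at h2
    have := (h1.trans h2).neg_right
    rwa [neg_sub] at this

lemma geom_not_dvd {p w : ℚ[X]} (hp : Prime p) (h : p ∣ 1 - w) (k : ℕ) (hk : 0 < k) :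
    ¬ p ∣ ∑ i ∈ range k, w ^ i := by
  intro hd
  have h1 : p ∣ ∑ i ∈ range k, (1 - w ^ i) := by
    apply dvd_sum
    intro i _
    have := sub_dvd_pow_sub_pow (1 : ℚ[X]) w i
    rw [one_pow] at this
    exact h.trans this
  have h2 := dvd_add hd h1
  rw [← sum_add_distrib] at h2
  simp only [add_sub_cancel, sum_const, card_range] at h2
  apply hp.not_isUnit
  apply isUnit_of_dvd_unit h2
  rw [nsmul_one]
  have : ((k : ℕ) : ℚ[X]) = C (k : ℚ) := by simp
  rw [this]
  exact isUnit_C.2 (isUnit_iff_ne_zero.2 (by exact_mod_cast hk.ne'))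

lemma cyc_good {s M : ℕ} (hs : 0 < s) (hM : 0 < M) :
    Good (cyclotomic (s * M) ℚ) (RatFunc.X ^ s) M := by
  have hsM : 0 < s * M := Nat.mul_pos hs hM
  have hp : Prime (cyclotomic (s * M) ℚ) := (cyclotomic.irreducible_rat hsM).prime
  have hX : algebraMap ℚ[X] (RatFunc ℚ) X = RatFunc.X := RatFunc.algebraMap_X
  have hy : algebraMap ℚ[X] (RatFunc ℚ) (X ^ s) = RatFunc.X ^ s := by rw [map_pow, hX]
  have h1y : ∀ i, algebraMap ℚ[X] (RatFunc ℚ) (1 - X ^ (s * i)) = 1 - (RatFunc.X ^ s) ^ i := by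
    intro i; rw [map_sub, map_one, pow_mul, map_pow, hy]
  have hXp : ¬ cyclotomic (s * M) ℚ ∣ X ^ s := by
    intro h
    have h1 := (cyc_dvd_iff hsM (s * M)).2 dvd_rfl
    have h2 := (hp.dvd_of_dvd_pow h).trans (dvd_pow_self (X : ℚ[X]) hsM.ne')
    exact hp.not_isUnit (isUnit_of_dvd_one (by simpa using dvd_add h1 h2))
  have hne : ∀ i, 0 < i → (1 : RatFunc ℚ) - (RatFunc.X ^ s) ^ i ≠ 0 := by
    intro i hi h
    rw [← h1y, map_eq_zero_iff _ (IsFractionRing.injective ℚ[X] (RatFunc ℚ)), sub_eq_zero] at h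
    have := congrArg natDegree h
    rw [natDegree_one, natDegree_X_pow] at this
    have := Nat.mul_pos hs hi
    omega
  have hgs : ∀ k, 0 < k → algebraMap ℚ[X] (RatFunc ℚ) (∑ i ∈ range k, (X ^ (s * M)) ^ i) =
      (1 - ((RatFunc.X ^ s) ^ M) ^ k) / (1 - (RatFunc.X ^ s) ^ M) := by
    intro k hk
    rw [eq_div_iff (hne M hM), ← h1y, ← map_mul, geom_sum_mul_neg]
    rw [map_sub, map_one, map_pow, map_pow, hX, ← pow_mul, ← pow_mul, ← pow_mul, mul_assoc]
  refine ⟨hp, ?_, ?_, ?_, ?_, ?_, hne, ?_, ?_⟩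
  · rw [← hy]; exact POrd.poly hp (by simp)
  · rw [← hy]; exact POrd.inv hp hXp
  · exact pow_ne_zero _ RatFunc.X_ne_zero
  · rw [← h1y]; exact POrd.poly hp (by rw [pow_one, cyc_dvd_iff hsM])
  · intro i hi
    rw [← h1y]; apply POrd.inv hp
    rw [cyc_dvd_iff hsM, Nat.mul_dvd_mul_iff_left hs]
    exact hi
  · intro k hk
    rw [← inv_div, ← hgs k hk]
    exact POrd.inv hp (geom_not_dvd hp ((cyc_dvd_iff hsM _).2 dvd_rfl) k hk)
  · intro k hk
    rw [← hgs k hk]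
    exact POrd.poly hp (by simp)

lemma Good.zpow {p : ℚ[X]} {y : RatFunc ℚ} {M : ℕ} (G : Good p y M) (k : ℤ) :
    POrd p 0 (y ^ k) := by
  obtain ⟨n, rfl | rfl⟩ := k.eq_nat_or_neg
  · rw [zpow_natCast]; exact POrd.pow G.hp G.h0 n
  · rw [zpow_neg, zpow_natCast, ← inv_pow]; exact POrd.pow G.hp G.hi n

lemma Good.zpow_one {p : ℚ[X]} {y : RatFunc ℚ} {M : ℕ} (G : Good p y M) (k : ℤ) :
    POrd p 1 (1 - y ^ ((M : ℤ) * k)) := by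
  have hnat : ∀ n : ℕ, POrd p 1 (1 - y ^ ((M : ℤ) * n)) := by
    intro n
    have := POrd.neg G.hp (G.shift 0 n)
    convert this using 1
    rw [add_zero, mul_comm n M, pow_zero, ← Nat.cast_mul, zpow_natCast]; ring
  obtain ⟨n, rfl | rfl⟩ := k.eq_nat_or_neg
  · exact hnat n
  · have := POrd.mulr G.hp (POrd.neg G.hp (hnat n)) (G.zpow ((M : ℤ) * -n))
    convert this using 1
    have e : y ^ ((M : ℤ) * n) * y ^ ((M : ℤ) * -n) = 1 := by
      rw [← zpow_add₀ G.y0]; simp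
    linear_combination -e

lemma summand (s k : ℕ) : (poch (RatFunc.X ^ s) (RatFunc.X ^ (2 * s)) k) ^ 2
    / (poch (RatFunc.X ^ (2 * s)) (RatFunc.X ^ (2 * s)) k) ^ 2 = (T (RatFunc.X ^ s) k) ^ 2 := by
  rw [T_eq, div_pow, ← pow_mul, mul_comm s 2]; rfl

/-- exponent bookkeeping -/
lemma expo (g h' j r : ℕ) (hj : 1 ≤ j) (hjr : j ≤ r) (hh : (2 * g + 1) ^ (j - 1) = 2 * h' + 1) :
    ∃ k : ℤ, (j = r → k = 0) ∧
    (1 - ((2 * g + 1 : ℕ) : ℤ)) * (1 + ((2 * g + 1 : ℕ) : ℤ) ^ (2 * r - 1)) / 4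
      - (2 * g + 1) * (h' * (h' + 1)) =
    - ((2 * g * h' + g + h') * (2 * g * h' + g + h' + 1)) + ((2 * g + 1) * (2 * h' + 1)) * k := by
  obtain ⟨d, rfl⟩ := Nat.exists_eq_add_of_le hjr
  obtain ⟨i, rfl⟩ := Nat.exists_eq_add_of_le hj
  rw [Nat.add_sub_cancel_left] at hh
  have hodd : Odd ((2 * g + 1) ^ d) := Odd.pow ⟨g, rfl⟩
  obtain ⟨u, hu⟩ := hodd
  have hw : ((2 * g + 1 : ℕ) : ℤ) ^ (2 * (1 + i + d) - 1) =
      (2 * g + 1) * (2 * h' + 1) * ((2 * h' + 1) * (2 * u + 1) * (2 * u + 1)) := by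
    have h1 : 2 * (1 + i + d) - 1 = 1 + i + i + d + d := by omega
    have h2 : ((2 * g + 1) ^ (1 + i + i + d + d) : ℕ) =
      (2 * g + 1) * (2 * h' + 1) * ((2 * h' + 1) * (2 * u + 1) * (2 * u + 1)) := by
      rw [pow_add, pow_add, pow_add, pow_add, hh, hu]; ring
    rw [h1]; exact_mod_cast h2
  rw [hw]
  refine ⟨- (g * (2 * h' + 1) * (2 * u * (u + 1))), ?_, ?_⟩
  · intro h
    have hd : d = 0 := by omega
    subst hd
    have : u = 0 := by simpa using hu.symm
    simp [this]
  · push_cast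
    have : (1 - (2 * (g : ℤ) + 1)) * (1 + (2 * g + 1) * (2 * h' + 1) * ((2 * h' + 1) * (2 * u + 1) * (2 * u + 1)))
      = 4 * ((2 * g + 1) * (h' * (h' + 1)) - ((2 * g * h' + g + h') * (2 * g * h' + g + h' + 1)) + ((2 * g + 1) * (2 * h' + 1)) * (- (g * (2 * h' + 1) * (2 * u * (u + 1))))) := by ring
    rw [this, Int.mul_ediv_cancel_left _ (by norm_num)]
    ring

lemma main_ord (g r j : ℕ) (hj : 1 ≤ j) (hjr : j ≤ r) :
    POrd (cyclotomic ((2 * g + 1) ^ j) ℚ) (if j = r then 2 else 1)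
      (∑ k ∈ range ((2 * g + 1) ^ r), (T RatFunc.X k) ^ 2 - (-1) ^ g * RatFunc.X ^
        ((1 - ((2 * g + 1 : ℕ) : ℤ)) * (1 + ((2 * g + 1 : ℕ) : ℤ) ^ (2 * r - 1)) / 4) *
        ∑ k ∈ range ((2 * g + 1) ^ (r - 1)), (T (RatFunc.X ^ (2 * g + 1)) k) ^ 2) := by
  have hodd : Odd ((2 * g + 1) ^ (j - 1)) := Odd.pow ⟨g, rfl⟩
  obtain ⟨h', hh⟩ := hodd
  obtain ⟨k, hk0, hk⟩ := expo g h' j r hj hjr hh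
  set E : ℤ := (1 - ((2 * g + 1 : ℕ) : ℤ)) * (1 + ((2 * g + 1 : ℕ) : ℤ) ^ (2 * r - 1)) / 4
  have hm : (2 * g + 1) ^ j = (2 * g + 1) * (2 * h' + 1) := by
    rw [← hh, ← pow_succ']; congr 1; omega
  set h := 2 * g * h' + g + h' with hhd
  have hm' : (2 * g + 1) * (2 * h' + 1) = 2 * h + 1 := by rw [hhd]; ring
  have hN : (2 * g + 1) ^ r = (2 * h + 1) * (2 * g + 1) ^ (r - j) := by
    rw [← hm', ← hm, ← pow_add]; congr 1; omega
  have hN' : (2 * g + 1) ^ (r - 1) = (2 * h' + 1) * (2 * g + 1) ^ (r - j) := by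
    rw [← hh, ← pow_add]; congr 1; omega
  have G1 := cyc_good (s := 1) (M := 2 * h + 1) (by omega) (by omega)
  have G2 := cyc_good (s := 2 * g + 1) (M := 2 * h' + 1) (by omega) (by omega)
  rw [pow_one, one_mul] at G1
  rw [hm'] at G2
  rw [hm, hm', hN, hN']
  set p := cyclotomic (2 * h + 1) ℚ
  have hx0 : (RatFunc.X : RatFunc ℚ) ≠ 0 := RatFunc.X_ne_zero
  have hsg : POrd p 0 ((-1) ^ g * RatFunc.X ^ E) :=
    POrd.mulr G1.hp (POrd.pow G1.hp (POrd.neg G1.hp (POrd.one G1.hp)) g) (G1.zpow E)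
  have hz : ((RatFunc.X : RatFunc ℚ) ^ (2 * g + 1)) ^ (2 * h' + 1) = RatFunc.X ^ (2 * h + 1) := by
    rw [← pow_mul, hm']
  have hsgn : (-1 : RatFunc ℚ) ^ h = (-1) ^ g * (-1) ^ h' := by
    rw [hhd, pow_add, pow_add, mul_assoc 2, pow_mul]; simp
  have hpw : ((-1 : RatFunc ℚ) ^ g * RatFunc.X ^ E) *
      ((-1) ^ h' * ((RatFunc.X ^ (2 * g + 1)) ^ (h' * (h' + 1)))⁻¹) =
      ((-1) ^ h * (RatFunc.X ^ (h * (h + 1)))⁻¹) * RatFunc.X ^ (((2 * h + 1 : ℕ) : ℤ) * k) := by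
    rw [hsgn, ← pow_mul, ← zpow_natCast RatFunc.X, ← zpow_natCast RatFunc.X, ← zpow_neg, ← zpow_neg]
    have e : E + -(((2 * g + 1) * (h' * (h' + 1)) : ℕ) : ℤ) =
      -((h * (h + 1) : ℕ) : ℤ) + ((2 * h + 1 : ℕ) : ℤ) * k := by
      rw [← hm']; push_cast [hhd]; linear_combination hk
    have e2 := congrArg (fun t : ℤ => (RatFunc.X : RatFunc ℚ) ^ t) e
    simp only [zpow_add₀ hx0] at e2
    linear_combination ((-1) ^ g * (-1) ^ h') * e2
  by_cases hjr' : j = r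
  · rw [if_pos hjr', hjr', Nat.sub_self, pow_zero, mul_one, mul_one]
    rw [hk0 hjr', mul_zero, zpow_zero, mul_one] at hpw
    have := POrd.sub G1.hp G1.key (POrd.mull G1.hp hsg G2.key)
    rw [mul_sub, hpw] at this
    convert this using 1; ring
  · rw [if_neg hjr']
    have L1 := G1.long ((2 * g + 1) ^ (r - j))
    have L2 := G2.long ((2 * g + 1) ^ (r - j))
    rw [hz] at L2
    have hA : POrd p 0 (∑ a ∈ range ((2 * g + 1) ^ (r - j)), (T (RatFunc.X ^ (2 * h + 1)) a) ^ 2) :=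
      POrd.sum G1.hp _ _ (fun a _ => POrd.pow G1.hp (G1.Tz_int a) 2)
    set A := ∑ a ∈ range ((2 * g + 1) ^ (r - j)), (T (RatFunc.X ^ (2 * h + 1)) a) ^ 2
    have hB : POrd p 0 ((-1) ^ h * (RatFunc.X ^ (h * (h + 1)))⁻¹) := by
      refine POrd.mulr G1.hp (POrd.pow G1.hp (POrd.neg G1.hp (POrd.one G1.hp)) h) ?_
      rw [← inv_pow]; exact POrd.pow G1.hp G1.hi _
    have h3 := POrd.mull G1.hp (POrd.mulr G1.hp hA hB) (G1.zpow_one k)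
    have := POrd.add G1.hp (POrd.sub G1.hp L1 (POrd.mull G1.hp hsg L2)) h3
    convert this using 1
    linear_combination -A * hpw

/-- for odd `n > 1` and `r ≥ 1`, modulo `Φ_{nʳ}(q)·∏_{j=1}^r Φ_{nʲ}(q)`:
`∑_{k=0}^{nʳ-1} (q;q²)²_k/(q²;q²)²_k
 ≡ (-1)^{(n-1)/2} q^{(1-n)(1+n^{2r-1})/4} ∑_{k=0}^{nʳ⁻¹-1} (qⁿ;q²ⁿ)²_k/(q²ⁿ;q²ⁿ)²_k`. -/
theorem stmt16 (n r : ℕ) (hn : 1 < n) (hodd : Odd n) (hr : 0 < r) :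
    (Polynomial.cyclotomic (n ^ r) ℚ * ∏ j ∈ Finset.Icc 1 r, Polynomial.cyclotomic (n ^ j) ℚ) ∣
      ((∑ k ∈ Finset.range (n ^ r),
          (poch RatFunc.X (RatFunc.X ^ 2) k) ^ 2
            / (poch (RatFunc.X ^ 2) (RatFunc.X ^ 2) k) ^ 2)
        - (-1) ^ ((n - 1) / 2)
            * RatFunc.X ^ (((1 - (n : ℤ)) * (1 + (n : ℤ) ^ (2 * r - 1))) / 4)
            * ∑ k ∈ Finset.range (n ^ (r - 1)),
                (poch (RatFunc.X ^ n) (RatFunc.X ^ (2 * n)) k) ^ 2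
                  / (poch (RatFunc.X ^ (2 * n)) (RatFunc.X ^ (2 * n)) k) ^ 2).num := by
  obtain ⟨g, rfl⟩ := hodd
  have hg : (2 * g + 1 - 1) / 2 = g := by omega
  have hs1 : ∀ k, (poch RatFunc.X (RatFunc.X ^ 2) k) ^ 2
      / (poch (RatFunc.X ^ 2) (RatFunc.X ^ 2) k) ^ 2 = (T RatFunc.X k) ^ 2 := by
    intro k; simpa using summand 1 k
  simp only [summand, hs1, hg]
  have hmain := fun j (h1 : 1 ≤ j) (h2 : j ≤ r) =>
    POrd.num (cyclotomic.irreducible_rat (pow_pos (by omega) j)).prime (main_ord g r j h1 h2)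
  set f := (∑ k ∈ range ((2 * g + 1) ^ r), (T RatFunc.X k) ^ 2 - (-1) ^ g * RatFunc.X ^
        ((1 - ((2 * g + 1 : ℕ) : ℤ)) * (1 + ((2 * g + 1 : ℕ) : ℤ) ^ (2 * r - 1)) / 4) *
        ∑ k ∈ range ((2 * g + 1) ^ (r - 1)), (T (RatFunc.X ^ (2 * g + 1)) k) ^ 2)
  have hcop : ∀ i j, i ≠ j →
      IsCoprime (cyclotomic ((2 * g + 1) ^ i) ℚ) (cyclotomic ((2 * g + 1) ^ j) ℚ) := by
    intro i j hij
    exact cyclotomic.isCoprime_rat (fun h => hij (Nat.pow_right_injective (by omega) h))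
  have e : cyclotomic ((2 * g + 1) ^ r) ℚ * ∏ j ∈ Icc 1 r, cyclotomic ((2 * g + 1) ^ j) ℚ =
      ∏ j ∈ Icc 1 r, cyclotomic ((2 * g + 1) ^ j) ℚ ^ (if j = r then 2 else 1) := by
    have h1 : r ∈ Icc 1 r := mem_Icc.2 ⟨hr, le_rfl⟩
    rw [← mul_prod_erase _ _ h1, ← mul_prod_erase _ _ h1, if_pos rfl, ← mul_assoc, ← sq]
    congr 1
    apply prod_congr rfl
    intro j hj
    rw [if_neg (ne_of_mem_erase hj), pow_one]
  rw [e]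
  apply Finset.prod_dvd_of_coprime
  · intro i _ j _ hij
    exact (hcop i j hij).pow
  · intro j hj
    have := mem_Icc.1 hj
    exact hmain j this.1 this.2
end

section
/- Let m and n be positive integers. Then ∑_{k=0}^{mn-1} q^k · C(2k,k)_q ≡ (−3|n) · q^{(n^2-1)/3} · ∑_{k=0}^{m-1} C(2k,k) modulo Φ_n(q), where (−3|n) is the Kronecker symbol of -3 at n and C(2k,k)_q is the Gaussian binomial coefficient. (Here q^{(n^2-1)/3} is interpreted appropriately: (n^2-1)/3 is an integer when 3 ∤ n, and when 3 | n the symbol (−3|n) is 0 so both sides with the right-hand factor vanish.) -/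
open Finset Polynomial

/-- The Gaussian binomial coefficient `C(M,N)_q` in `ℚ(q)`. -/
noncomputable def qbinom (M N : ℕ) : RatFunc ℚ :=
  if N ≤ M then
    poch RatFunc.X RatFunc.X M / (poch RatFunc.X RatFunc.X N * poch RatFunc.X RatFunc.X (M - N))
  else 0

/-- The Kronecker symbol `(-3 | n)` for positive integers `n`: since `-3 ≡ 1 (mod 4)`,
it is the character mod 3, i.e. `1, -1, 0` according as `n ≡ 1, 2, 0 (mod 3)`. -/
def kroneckerNeg3 (n : ℕ) : ℤ :=
  if n % 3 = 0 then 0 else if n % 3 = 1 then 1 else -1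

/-- Gaussian binomials by the Pascal recursion, in any commutative ring. -/
def gq {R : Type*} [CommRing R] (q : R) : ℕ → ℕ → R
  | _, 0 => 1
  | 0, _ + 1 => 0
  | M + 1, r + 1 => gq q M r + q ^ (r + 1) * gq q M (r + 1)

section gq
variable {R : Type*} [CommRing R] (q : R)

theorem gq_zero (M : ℕ) : gq q M 0 = 1 := by cases M <;> rfl

theorem gq_succ (M r : ℕ) :
    gq q (M + 1) (r + 1) = gq q M r + q ^ (r + 1) * gq q M (r + 1) := rfl

theorem gq_lt (M : ℕ) : ∀ r, M < r → gq q M r = 0 := by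
  induction M with
  | zero => intro r hr; cases r with
    | zero => omega
    | succ r => rfl
  | succ M ih => intro r hr; cases r with
    | zero => omega
    | succ r => rw [gq_succ, ih r (by omega), ih (r + 1) (by omega)]; ring

theorem gq_self (M : ℕ) : gq q M M = 1 := by
  induction M with
  | zero => rfl
  | succ M ih => rw [gq_succ, ih, gq_lt q M (M + 1) (by omega)]; ring

theorem gq_succ' (M : ℕ) : ∀ r s, M = r + s →
    gq q (M + 1) (r + 1) = gq q M (r + 1) + q ^ s * gq q M r := by
  induction M with
  | zero =>
    intro r s h
    obtain rfl : r = 0 := by omega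
    obtain rfl : s = 0 := by omega
    simp [gq]
  | succ M ih =>
    intro r s h
    rcases s with _ | s
    · obtain rfl : r = M + 1 := by omega
      rw [gq_self, gq_self, gq_lt _ _ _ (by omega : M + 1 < M + 1 + 1)]; ring
    · have h1 := ih r s (by omega)
      rcases r with _ | r
      · have h2 := gq_succ q M 0
        rw [gq_succ q (M + 1) 0]
        rw [gq_zero] at h1 h2 ⊢
        linear_combination q ^ (0 + 1) * h1 - h2
      · have h2 := ih r (s + 1) (by omega)
        have h3 := gq_succ q M r
        have h4 := gq_succ q M (r + 1)
        rw [gq_succ q (M + 1) (r + 1)]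
        linear_combination h2 + q ^ (r + 2) * h1 - h4 - q ^ (s + 1) * h3

theorem gq_poch (a : ℕ) : ∀ b, gq q (a + b) a * ((∏ i ∈ range a, (1 - q * q ^ i)) *
    (∏ i ∈ range b, (1 - q * q ^ i))) = ∏ i ∈ range (a + b), (1 - q * q ^ i) := by
  induction a with
  | zero => intro b; simp [gq_zero]
  | succ a iha =>
    intro b
    induction b with
    | zero => simp [gq_self]
    | succ b ihb =>
      have h1 := iha (b + 1)
      have e : a + 1 + (b + 1) = (a + (b + 1)) + 1 := by ring
      have e2 : a + 1 + b = a + (b + 1) := by ring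
      rw [e2] at ihb
      rw [e, gq_succ, prod_range_succ _ (a + (b + 1))]
      rw [prod_range_succ _ a] at *
      rw [prod_range_succ _ b] at *
      linear_combination (1 - q * q ^ a) * h1 + q ^ (a + 1) * (1 - q * q ^ b) * ihb

theorem gq_step (n i : ℕ) :
    q ^ (3 * i * (2 * i + 1)) * (gq q (2 * n + 2) (n + 3 * i + 2) - gq q (2 * n) (n + 3 * i + 1))
    - q ^ (3 * (i + 1) * (2 * i + 1)) *
        (gq q (2 * n + 2) (n + 3 * i + 3) - gq q (2 * n) (n + 3 * i + 2))
    = q ^ (n + 6 * i ^ 2) * gq q (2 * n) (n + 3 * i)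
      - q ^ (n + 6 * (i + 1) ^ 2) * gq q (2 * n) (n + 3 * i + 3) := by
  rcases lt_trichotomy n (3 * i) with h | h | h
  · simp only [gq_lt q (2 * n + 2) (n + 3 * i + 2) (by omega), gq_lt q (2 * n) (n + 3 * i + 1) (by omega),
      gq_lt q (2 * n + 2) (n + 3 * i + 3) (by omega), gq_lt q (2 * n) (n + 3 * i + 2) (by omega),
      gq_lt q (2 * n) (n + 3 * i) (by omega), gq_lt q (2 * n) (n + 3 * i + 3) (by omega)]
    ring
  · rw [gq_lt q (2 * n) (n + 3 * i + 1) (by omega),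
      gq_lt q (2 * n + 2) (n + 3 * i + 3) (by omega), gq_lt q (2 * n) (n + 3 * i + 2) (by omega),
      gq_lt q (2 * n) (n + 3 * i + 3) (by omega)]
    have e1 : n + 3 * i + 2 = 2 * n + 2 := by omega
    have e2 : n + 3 * i = 2 * n := by omega
    rw [e1, e2, gq_self, gq_self, h]
    ring
  · obtain ⟨t, rfl⟩ : ∃ t, n = 3 * i + 1 + t := ⟨n - (3 * i + 1), by omega⟩
    set n := 3 * i + 1 + t with hn
    have a1 := gq_succ q (2 * n + 1) (n + 3 * i + 1)
    have a2 := gq_succ' q (2 * n) (n + 3 * i) (t + 1) (by omega)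
    have a3 := gq_succ' q (2 * n) (n + 3 * i + 1) t (by omega)
    have b1 := gq_succ' q (2 * n + 1) (n + 3 * i + 2) t (by omega)
    have b2 := gq_succ q (2 * n) (n + 3 * i + 2)
    simp only [add_assoc, Nat.reduceAdd] at *
    rw [b1, a1, b2, a3, a2, hn]
    ring

theorem gq_tele (n I : ℕ) :
    ∑ i ∈ range I, (q ^ (3 * i * (2 * i + 1)) * gq q (2 * n + 2) (n + 1 + 3 * i + 1)
      - q ^ (3 * (i + 1) * (2 * i + 1)) * gq q (2 * n + 2) (n + 1 + 3 * i + 2)) =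
    ∑ i ∈ range I, (q ^ (3 * i * (2 * i + 1)) * gq q (2 * n) (n + 3 * i + 1)
      - q ^ (3 * (i + 1) * (2 * i + 1)) * gq q (2 * n) (n + 3 * i + 2)) +
    q ^ n * gq q (2 * n) n - q ^ (n + 6 * I ^ 2) * gq q (2 * n) (n + 3 * I) := by
  induction I with
  | zero => simp
  | succ I ih =>
    rw [sum_range_succ, sum_range_succ, ih]
    have h := gq_step q n I
    have e1 : n + 1 + 3 * I + 1 = n + 3 * I + 2 := by ring
    have e2 : n + 1 + 3 * I + 2 = n + 3 * I + 3 := by ring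
    have e3 : n + 3 * (I + 1) = n + 3 * I + 3 := by ring
    rw [e1, e2, e3]
    linear_combination h

theorem gq_tauraso (I n : ℕ) (h : n ≤ 3 * I) :
    ∑ k ∈ range n, q ^ k * gq q (2 * k) k =
    ∑ i ∈ range I, (q ^ (3 * i * (2 * i + 1)) * gq q (2 * n) (n + 3 * i + 1)
      - q ^ (3 * (i + 1) * (2 * i + 1)) * gq q (2 * n) (n + 3 * i + 2)) := by
  induction n with
  | zero =>
    symm
    simp only [range_zero, sum_empty]
    apply sum_eq_zero
    intro i _
    rw [gq_lt _ _ _ (by omega), gq_lt _ _ _ (by omega)]; ring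
  | succ n ih =>
    rw [sum_range_succ, ih (by omega), show 2 * (n + 1) = 2 * n + 2 by ring, gq_tele,
      gq_lt q (2 * n) (n + 3 * I) (by omega)]
    ring

theorem map_gq {S : Type*} [CommRing S] (f : R →+* S) (M : ℕ) :
    ∀ r, f (gq q M r) = gq (f q) M r := by
  induction M with
  | zero => intro r; cases r <;> simp [gq]
  | succ M ih => intro r; cases r <;> simp [gq, ih]

end gq

section root
variable {K : Type*} [Field K] {ζ : K} {n : ℕ}

theorem gq_root (hn : 0 < n) (h : IsPrimitiveRoot ζ n) (d : ℕ) (h0 : 0 < d) (h1 : d < n) :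
    gq ζ n d = 0 := by
  have key := gq_poch ζ d (n - d)
  rw [show d + (n - d) = n by omega] at key
  have hz : ∏ i ∈ range n, (1 - ζ * ζ ^ i) = 0 := by
    apply prod_eq_zero (i := n - 1) (by simp; omega)
    rw [← pow_succ', show n - 1 + 1 = n by omega, h.pow_eq_one, sub_self]
  have hnz : ∀ e, e < n → ∏ i ∈ range e, (1 - ζ * ζ ^ i) ≠ 0 := by
    intro e he
    rw [prod_ne_zero_iff]
    intro i hi
    rw [mem_range] at hi
    rw [← pow_succ', sub_ne_zero]
    exact (h.pow_ne_one_of_pos_of_lt (by omega) (by omega)).symm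
  rw [hz] at key
  exact (mul_eq_zero.mp key).resolve_right (mul_ne_zero (hnz _ h1) (hnz _ (by omega)))

theorem gq_add (hn : 0 < n) (h : IsPrimitiveRoot ζ n) (M : ℕ) :
    ∀ r, gq ζ (M + n) r = gq ζ M r + if n ≤ r then gq ζ M (r - n) else 0 := by
  induction M with
  | zero =>
    intro r
    rw [zero_add]
    rcases Nat.eq_zero_or_pos r with rfl | hr
    · simp [gq_zero]; omega
    rw [gq_lt ζ 0 r hr]
    rcases lt_trichotomy r n with h1 | h1 | h1
    · rw [gq_root hn h r hr h1, if_neg (by omega)]; ring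
    · subst h1; simp [gq_self]
    · rw [gq_lt ζ n r h1, if_pos (by omega), gq_lt ζ 0 _ (by omega)]; ring
  | succ M ih =>
    intro r
    rcases r with _ | r
    · simp [gq_zero]; omega
    rw [show M + 1 + n = (M + n) + 1 by ring, gq_succ, gq_succ, ih r, ih (r + 1)]
    rcases lt_trichotomy (r + 1) n with h1 | h1 | h1
    · rw [if_neg (by omega), if_neg (by omega), if_neg (by omega)]; ring
    · rw [if_neg (by omega), if_pos (by omega), if_pos (by omega), h1, Nat.sub_self, gq_zero,
        gq_zero, h.pow_eq_one]; ring
    · rw [if_pos (by omega), if_pos (by omega), if_pos (by omega)]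
      obtain ⟨s, rfl⟩ : ∃ s, r = s + n := ⟨r - n, by omega⟩
      rw [show s + n + 1 - n = s + 1 by omega, show s + n - n = s by omega, gq_succ,
        show s + n + 1 = (s + 1) + n by ring, pow_add ζ (s + 1) n, h.pow_eq_one]
      ring

theorem gq_lucas (hn : 0 < n) (h : IsPrimitiveRoot ζ n) (b d : ℕ) (hb : b < n) (hd : d < n)
    (a : ℕ) : ∀ c, gq ζ (a * n + b) (c * n + d) = (a.choose c : K) * gq ζ b d := by
  induction a with
  | zero =>
    intro c
    rcases c with _ | c
    · simp
    · rw [gq_lt _ _ _ (by nlinarith)]; simp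
  | succ a ih =>
    intro c
    rw [show (a + 1) * n + b = (a * n + b) + n by ring, gq_add hn h, ih c]
    rcases c with _ | c
    · rw [if_neg (by omega)]; simp
    · rw [if_pos (by nlinarith), show (c + 1) * n + d - n = c * n + d by
        rw [add_mul]; omega, ih c, Nat.choose_succ_succ]
      push_cast; ring

theorem gq_central (hn : 0 < n) (h : IsPrimitiveRoot ζ n) (a b : ℕ) (hb : b < n) :
    gq ζ (2 * (a * n + b)) (a * n + b) = ((2 * a).choose a : K) * gq ζ (2 * b) b := by
  by_cases h2 : 2 * b < n
  · rw [show 2 * (a * n + b) = (2 * a) * n + 2 * b by ring, gq_lucas hn h _ _ h2 hb]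
  · obtain ⟨e, he⟩ : ∃ e, 2 * b = n + e := ⟨2 * b - n, by omega⟩
    have z : gq ζ e b = 0 := gq_lt _ _ _ (by omega)
    have l := gq_lucas hn h e b (by omega) hb 1 0
    rw [show 2 * (a * n + b) = (2 * a + 1) * n + e by linarith,
      gq_lucas hn h e b (by omega) hb, he, z]
    rw [one_mul, zero_mul, zero_add, z] at l
    rw [l]; ring

theorem sum_blocks (hn : 0 < n) (h : IsPrimitiveRoot ζ n) (m : ℕ) :
    ∑ k ∈ range (m * n), ζ ^ k * gq ζ (2 * k) k =
      (∑ k ∈ range n, ζ ^ k * gq ζ (2 * k) k) * ∑ k ∈ range m, ((2 * k).choose k : K) := by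
  induction m with
  | zero => simp
  | succ m ih =>
    rw [add_mul, one_mul, sum_range_add, ih, sum_range_succ, mul_add, add_right_inj, sum_mul]
    apply sum_congr rfl
    intro b hb
    rw [gq_central hn h m b (mem_range.mp hb), pow_add, mul_comm m n, pow_mul, h.pow_eq_one]
    ring

theorem gq_two (hn : 0 < n) (h : IsPrimitiveRoot ζ n) (j : ℕ) (hj : 0 < j) :
    gq ζ (2 * n) (n + j) = if j = n then 1 else 0 := by
  split_ifs with h1
  · rw [h1, two_mul, gq_self]
  · rcases lt_or_gt_of_ne h1 with h2 | h2
    · have := gq_lucas hn h 0 j hn h2 2 1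
      rw [add_zero, one_mul, gq_lt ζ 0 j hj, mul_zero] at this
      exact this
    · exact gq_lt _ _ _ (by omega)

theorem sum_one (hn : 0 < n) (h : IsPrimitiveRoot ζ n) :
    ∑ k ∈ range n, ζ ^ k * gq ζ (2 * k) k =
      (kroneckerNeg3 n : K) * ζ ^ ((n ^ 2 - 1) / 3) := by
  rw [gq_tauraso ζ (n / 3 + 1) n (by omega)]
  have hs : ∀ i, (ζ ^ (3 * i * (2 * i + 1)) * gq ζ (2 * n) (n + 3 * i + 1)
      - ζ ^ (3 * (i + 1) * (2 * i + 1)) * gq ζ (2 * n) (n + 3 * i + 2)) =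
      (ζ ^ (3 * i * (2 * i + 1)) * (if 3 * i + 1 = n then 1 else 0)
      - ζ ^ (3 * (i + 1) * (2 * i + 1)) * (if 3 * i + 2 = n then 1 else 0)) := by
    intro i
    rw [add_assoc, add_assoc, gq_two hn h _ (by omega), gq_two hn h _ (by omega)]
  rw [sum_congr rfl (fun i _ => hs i)]
  unfold kroneckerNeg3
  obtain ⟨s, hs3⟩ : ∃ s, n = 3 * s ∨ n = 3 * s + 1 ∨ n = 3 * s + 2 := ⟨n / 3, by omega⟩
  rcases hs3 with h3 | h3 | h3
  · rw [if_pos (by omega), sum_eq_zero]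
    · simp
    · intro i _
      rw [if_neg (by omega), if_neg (by omega)]; ring
  · rw [if_neg (by omega), if_pos (by omega), sum_eq_single s]
    · have e : (n ^ 2 - 1) / 3 = 3 * s ^ 2 + 2 * s := by
        have : n ^ 2 = 3 * (3 * s ^ 2 + 2 * s) + 1 := by rw [h3]; ring
        omega
      have e2 : 3 * s * (2 * s + 1) = n * s + (3 * s ^ 2 + 2 * s) := by rw [h3]; ring
      rw [if_pos (by omega), if_neg (by omega), e, e2, pow_add, pow_mul, h.pow_eq_one]
      simp
    · intro i _ hi
      rw [if_neg (by omega), if_neg (by omega)]; ring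
    · intro hi
      exact absurd (mem_range.mpr (by omega)) hi
  · rw [if_neg (by omega), if_neg (by omega), sum_eq_single s]
    · have e : (n ^ 2 - 1) / 3 = 3 * s ^ 2 + 4 * s + 1 := by
        have : n ^ 2 = 3 * (3 * s ^ 2 + 4 * s + 1) + 1 := by rw [h3]; ring
        omega
      have e2 : 3 * (s + 1) * (2 * s + 1) = n * (s + 1) + (3 * s ^ 2 + 4 * s + 1) := by
        rw [h3]; ring
      rw [if_neg (by omega), if_pos (by omega), e, e2, pow_add, pow_mul ζ n (s + 1), h.pow_eq_one]
      simp
    · intro i _ hi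
      rw [if_neg (by omega), if_neg (by omega)]; ring
    · intro hi
      exact absurd (mem_range.mpr (by omega)) hi

end root

theorem one_sub_X_pow_ne (i : ℕ) : (1 : RatFunc ℚ) - RatFunc.X * RatFunc.X ^ i ≠ 0 := by
  have hp : (1 - Polynomial.X * Polynomial.X ^ i : ℚ[X]) ≠ 0 := by
    intro h0
    have := congrArg (Polynomial.eval 0) h0
    simp at this
  have := (map_ne_zero_iff (algebraMap ℚ[X] (RatFunc ℚ)) (RatFunc.algebraMap_injective ℚ)).mpr hp
  simpa using this

theorem qbinom_eq (k : ℕ) :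
    qbinom (2 * k) k = algebraMap ℚ[X] (RatFunc ℚ) (gq Polynomial.X (2 * k) k) := by
  rw [map_gq, RatFunc.algebraMap_X]
  unfold qbinom poch
  rw [if_pos (by omega), show 2 * k - k = k by omega, div_eq_iff, two_mul, gq_poch]
  exact mul_ne_zero (prod_ne_zero_iff.mpr fun i _ => one_sub_X_pow_ne i)
    (prod_ne_zero_iff.mpr fun i _ => one_sub_X_pow_ne i)

/-- for positive `m, n`, modulo `Φ_n(q)`:
`∑_{k=0}^{mn-1} q^k C(2k,k)_q ≡ (-3|n)·q^{(n²-1)/3}·∑_{k=0}^{m-1} C(2k,k)`. -/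
theorem stmt18 (m n : ℕ) (hm : 0 < m) (hn : 0 < n) :
    (Polynomial.cyclotomic n ℚ) ∣
      ((∑ k ∈ Finset.range (m * n), RatFunc.X ^ k * qbinom (2 * k) k)
        - (kroneckerNeg3 n : RatFunc ℚ) * RatFunc.X ^ ((n ^ 2 - 1) / 3)
            * RatFunc.C (∑ k ∈ Finset.range m, ((2 * k).choose k : ℚ))).num := by
  have key : ((∑ k ∈ Finset.range (m * n), RatFunc.X ^ k * qbinom (2 * k) k)
        - (kroneckerNeg3 n : RatFunc ℚ) * RatFunc.X ^ ((n ^ 2 - 1) / 3)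
            * RatFunc.C (∑ k ∈ Finset.range m, ((2 * k).choose k : ℚ))) =
      algebraMap ℚ[X] (RatFunc ℚ)
        ((∑ k ∈ Finset.range (m * n), Polynomial.X ^ k * gq Polynomial.X (2 * k) k)
        - (kroneckerNeg3 n : ℚ[X]) * Polynomial.X ^ ((n ^ 2 - 1) / 3)
            * Polynomial.C (∑ k ∈ Finset.range m, ((2 * k).choose k : ℚ))) := by
    simp only [map_sub, map_sum, map_mul, map_pow, map_intCast, RatFunc.algebraMap_X,
      RatFunc.algebraMap_C, qbinom_eq]
  rw [key, RatFunc.num_algebraMap]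
  have hζ := Complex.isPrimitiveRoot_exp n hn.ne'
  rw [Polynomial.cyclotomic_eq_minpoly_rat hζ hn]
  apply minpoly.dvd
  have hm1 : ∀ k, Polynomial.aeval (Complex.exp (2 * Real.pi * Complex.I / n))
      (gq (Polynomial.X : ℚ[X]) (2 * k) k)
      = gq (Complex.exp (2 * Real.pi * Complex.I / n)) (2 * k) k := by
    intro k
    have := map_gq (Polynomial.X : ℚ[X]) (Polynomial.aeval
      (Complex.exp (2 * Real.pi * Complex.I / n)) : ℚ[X] →ₐ[ℚ] ℂ).toRingHom (2 * k) k
    simpa using this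
  simp only [map_sub, map_sum, map_mul, map_pow, map_intCast, Polynomial.aeval_X, hm1,
    map_natCast]
  rw [sum_blocks hn hζ, sum_one hn hζ, sub_self]
end
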